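/- arXiv:1103.2601 — 7 statements merged into one kernel-verified Lean document; each statement's English description precedes it below -/
import Mathlib

section
/- Let {K1, K2} be a proper pair of cliques in a finite simple graph G. Then the subgraph of G induced on K1 ∪ K2 contains an induced chordless cycle on four vertices (an induced C4). -/
open SimpleGraph

variable {V : Type*}

/-- `x` is complete to the set `S`: adjacent to every vertex of `S`. -/
def IsCompleteTo (G : SimpleGraph V) (x : V) (S : Set V) : Prop :=
  ∀ s ∈ S, G.Adj x s

/-- `x` is anticomplete to the set `S`: adjacent to no vertex of `S`. -/
def IsAnticompleteTo (G : SimpleGraph V) (x : V) (S : Set V) : Prop :=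
  ∀ s ∈ S, ¬ G.Adj x s

/-- `x` is proper to `S`: neither complete nor anticomplete to `S`. -/
def IsProperTo (G : SimpleGraph V) (x : V) (S : Set V) : Prop :=
  ¬ IsCompleteTo G x S ∧ ¬ IsAnticompleteTo G x S

/-- `v` is universal to `u`: `v` is adjacent to `u` and to every vertex of `N(u) \ {v}`. -/
def IsUniversalTo (G : SimpleGraph V) (v u : V) : Prop :=
  G.Adj v u ∧ ∀ w, G.Adj u w → w ≠ v → G.Adj v w

/-- `{K1, K2}` is a homogeneous pair of cliques. -/
def IsHomogeneousPair (G : SimpleGraph V) (K1 K2 : Set V) : Prop :=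
  K1.Nonempty ∧ K2.Nonempty ∧ Disjoint K1 K2 ∧ G.IsClique K1 ∧ G.IsClique K2 ∧
    ∀ z, z ∉ K1 ∪ K2 →
      (IsCompleteTo G z K1 ∨ IsAnticompleteTo G z K1) ∧
      (IsCompleteTo G z K2 ∨ IsAnticompleteTo G z K2)

/-- `{K1, K2}` is a proper pair of cliques. -/
def IsProperPair (G : SimpleGraph V) (K1 K2 : Set V) : Prop :=
  K1.Nonempty ∧ K2.Nonempty ∧ Disjoint K1 K2 ∧ G.IsClique K1 ∧ G.IsClique K2 ∧
    (∀ u ∈ K1, IsProperTo G u K2) ∧ (∀ u ∈ K2, IsProperTo G u K1)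

/-- A proper and homogeneous (PH) pair of cliques. -/
def IsPHPair (G : SimpleGraph V) (K1 K2 : Set V) : Prop :=
  IsProperPair G K1 K2 ∧ IsHomogeneousPair G K1 K2

/-- The subgraph of `G` induced on `S` contains an induced (chordless) cycle on four vertices. -/
def HasInducedC4On (G : SimpleGraph V) (S : Set V) : Prop :=
  ∃ a b c d, a ∈ S ∧ b ∈ S ∧ c ∈ S ∧ d ∈ S ∧
    a ≠ b ∧ a ≠ c ∧ a ≠ d ∧ b ≠ c ∧ b ≠ d ∧ c ≠ d ∧
    G.Adj a b ∧ G.Adj b c ∧ G.Adj c d ∧ G.Adj d a ∧ ¬ G.Adj a c ∧ ¬ G.Adj b d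

/-- `{A1, A2}` is a C4-free pair of cliques: non-empty, vertex-disjoint, not complete
to each other, and the subgraph induced on `A1 ∪ A2` has no induced `C4`. -/
def IsC4FreePair (G : SimpleGraph V) (A1 A2 : Set V) : Prop :=
  A1.Nonempty ∧ A2.Nonempty ∧ Disjoint A1 A2 ∧ G.IsClique A1 ∧ G.IsClique A2 ∧
    (∃ a ∈ A1, ∃ b ∈ A2, ¬ G.Adj a b) ∧ ¬ HasInducedC4On G (A1 ∪ A2)

/-- Two adjacent vertices `u, v` have a PH-embedding: they are not universal to each
other and some PH pair of cliques `{Q1, Q2}` satisfies `u, v ∈ Q1`. -/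
def HasPHEmbedding (G : SimpleGraph V) (u v : V) : Prop :=
  G.Adj u v ∧ ¬ IsUniversalTo G u v ∧ ¬ IsUniversalTo G v u ∧
    ∃ Q1 Q2, IsPHPair G Q1 Q2 ∧ u ∈ Q1 ∧ v ∈ Q1

/-- Lemma 5: if {K1, K2} is a proper pair of cliques, then the subgraph induced on
K1 ∪ K2 contains an induced C4. -/
theorem proper_pair_hasInducedC4 [Fintype V] (G : SimpleGraph V) (K1 K2 : Set V)
    (hprop : IsProperPair G K1 K2) :
    HasInducedC4On G (K1 ∪ K2) := by
  classical
  obtain ⟨h1, -, hd, c1, c2, p1, p2⟩ := hprop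
  obtain ⟨u, hu, hmax⟩ := (Set.toFinite K1).exists_maximalFor
    (fun x => {y | y ∈ K2 ∧ G.Adj x y}) K1 h1
  have hne : ∀ x ∈ K1, ∀ y ∈ K2, x ≠ y := fun x hx y hy h =>
    Set.disjoint_left.mp hd hx (h ▸ hy)
  obtain ⟨b, hb, hub⟩ : ∃ b ∈ K2, ¬ G.Adj u b := by
    have := (p1 u hu).1
    unfold IsCompleteTo at this
    push Not at this
    exact this
  obtain ⟨c, hc, hbc⟩ : ∃ c ∈ K1, G.Adj b c := by
    have := (p2 b hb).2
    unfold IsAnticompleteTo at this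
    push Not at this
    exact this
  obtain ⟨d, hdK, hud, hcd⟩ : ∃ d ∈ K2, G.Adj u d ∧ ¬ G.Adj c d := by
    by_contra hcon
    push Not at hcon
    exact hub (hmax hc (fun y hy => ⟨hy.1, hcon y hy.1 hy.2⟩) ⟨hb, hbc.symm⟩).2
  have huc : u ≠ c := fun h => hub (h ▸ hbc.symm)
  have hbd : b ≠ d := fun h => hub (h ▸ hud)
  exact ⟨u, c, b, d, Or.inl hu, Or.inl hc, Or.inr hb, Or.inr hdK, huc, hne u hu b hb,
    hne u hu d hdK, hne c hc b hb, hne c hc d hdK, hbd, c1 hu hc huc, hbc.symm,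
    c2 hb hdK hbd, hud.symm, hub, hcd⟩
end

section
/- Let G be a finite simple graph and let {A1, A2} be a pair of non-empty vertex-disjoint cliques that are not complete to each other, such that the subgraph of G induced on A1 ∪ A2 contains no induced C4. Then {A1, A2} is not a proper pair, i.e., some vertex of A1 is complete or anticomplete to A2, or some vertex of A2 is complete or anticomplete to A1. -/
open SimpleGraph

variable {V : Type*}

/-- A pair of non-empty vertex-disjoint cliques, not complete to each other, whose union
induces no C4, is not a proper pair. -/
theorem c4free_pair_not_proper [Fintype V] (G : SimpleGraph V) (A1 A2 : Set V)
    (h1 : A1.Nonempty) (h2 : A2.Nonempty) (hdisj : Disjoint A1 A2)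
    (hc1 : G.IsClique A1) (hc2 : G.IsClique A2)
    (hnc : ∃ a ∈ A1, ∃ b ∈ A2, ¬ G.Adj a b)
    (hC4 : ¬ HasInducedC4On G (A1 ∪ A2)) :
    (∃ x ∈ A1, IsCompleteTo G x A2 ∨ IsAnticompleteTo G x A2) ∨
    (∃ x ∈ A2, IsCompleteTo G x A1 ∨ IsAnticompleteTo G x A1) := by
  obtain ⟨x, hx, hmax⟩ := Set.Finite.exists_maximalFor
    (fun x => {y | y ∈ A2 ∧ G.Adj x y}) A1 (Set.toFinite _) h1
  by_cases hcomp : IsCompleteTo G x A2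
  · exact Or.inl ⟨x, hx, Or.inl hcomp⟩
  unfold IsCompleteTo at hcomp
  push Not at hcomp
  obtain ⟨y, hy, hxy⟩ := hcomp
  by_cases hanti : IsAnticompleteTo G y A1
  · exact Or.inr ⟨y, hy, Or.inr hanti⟩
  unfold IsAnticompleteTo at hanti
  push Not at hanti
  obtain ⟨x', hx', hyx'⟩ := hanti
  have hz : ∃ z ∈ A2, G.Adj x z ∧ ¬ G.Adj x' z := by
    by_contra hcon
    push Not at hcon
    have hsub : {y | y ∈ A2 ∧ G.Adj x' y} ⊆ {y | y ∈ A2 ∧ G.Adj x y} :=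
      hmax hx' (fun z hz => ⟨hz.1, hcon z hz.1 hz.2⟩)
    exact hxy (hsub ⟨hy, hyx'.symm⟩).2
  obtain ⟨z, hz, hxz, hxz'⟩ := hz
  have hne : x ≠ x' := by
    rintro rfl
    exact hxy hyx'.symm
  have hne2 : y ≠ z := by
    rintro rfl
    exact hxy hxz
  have hd : ∀ a ∈ A1, ∀ b ∈ A2, a ≠ b := fun a ha b hb => hdisj.ne_of_mem ha hb
  exact absurd ⟨x, x', y, z, Or.inl hx, Or.inl hx', Or.inr hy, Or.inr hz,
    hne, hd x hx y hy, hd x hx z hz, hd x' hx' y hy, hd x' hx' z hz, hne2,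
    hc1 hx hx' hne, hyx'.symm, hc2 hy hz hne2, hxz.symm, hxy, hxz'⟩ hC4
end

section
/- Let G be a finite simple graph. If no pair of vertices of G has a PH-embedding, then G has no proper and homogeneous pair of cliques. -/
open SimpleGraph

variable {V : Type*}

/-- Lemma 7: if no pair of vertices of G has a PH-embedding, then G has no proper
and homogeneous pair of cliques. -/
theorem no_PHembedding_no_PHpair [Fintype V] (G : SimpleGraph V)
    (h : ∀ u v : V, ¬ HasPHEmbedding G u v) :
    ∀ K1 K2 : Set V, ¬ IsPHPair G K1 K2 := by
  classical
  intro K1 K2 hPH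
  obtain ⟨⟨hne, -, hdis, hc1, -, hp1, hp2⟩, -⟩ := id hPH
  obtain ⟨u, hu, hmax⟩ := (Set.toFinite K1).exists_maximalFor
    (fun x => {w | w ∈ K2 ∧ G.Adj x w}) K1 hne
  obtain ⟨b, hb, hub⟩ : ∃ b ∈ K2, ¬ G.Adj u b := by
    have := (hp1 u hu).1
    unfold IsCompleteTo at this
    push Not at this
    exact this
  obtain ⟨v, hv, hbv⟩ : ∃ v ∈ K1, G.Adj b v := by
    have := (hp2 b hb).2
    unfold IsAnticompleteTo at this
    push Not at this
    exact this
  have huv : u ≠ v := by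
    rintro rfl
    exact hub hbv.symm
  have hK : ∀ x ∈ K1, ∀ y ∈ K2, y ≠ x := by
    rintro x hx y hy rfl
    exact Set.disjoint_left.mp hdis hx hy
  refine h u v ⟨hc1 hu hv huv, ?_, ?_, K1, K2, hPH, hu, hv⟩
  · intro hun
    exact hub (hun.2 b hbv.symm (hK u hu b hb))
  · intro hun
    have hle := hmax hv (fun w hw => ⟨hw.1, hun.2 w hw.2 (hK v hv w hw.1)⟩)
    exact hub (hle ⟨hb, hbv.symm⟩).2
end

section
/- Let G be a finite simple graph with a proper and homogeneous (PH) pair of cliques {K1, K2} and a C4-free homogeneous pair of cliques {A1, A2}. Then for each i ∈ {1,2}, K_i ∩ A1 = ∅ or K_i ∩ A2 = ∅. -/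
open SimpleGraph

variable {V : Type*}

/-- One vertex outside both cliques of the PH pair contradicts properness. -/
theorem PHpair_aux_side (G : SimpleGraph V) (K2 A : Set V) (x a : V)
    (hxA : x ∈ A) (haA : a ∈ A) (hx : IsProperTo G x K2)
    (ha : IsCompleteTo G a K2 ∨ IsAnticompleteTo G a K2)
    (hK : ∀ y ∈ K2, IsCompleteTo G y A ∨ IsAnticompleteTo G y A) : False := by
  obtain ⟨h1, h2⟩ := hx
  simp only [IsCompleteTo, IsAnticompleteTo, not_forall, not_not] at *
  obtain ⟨w, hw, hxw⟩ := h1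
  obtain ⟨y, hy, hxy⟩ := h2
  have hyA : G.Adj a y := by
    rcases hK y hy with h | h
    · exact (h a haA).symm
    · exact absurd hxy.symm (h x hxA)
  have hwA : ¬ G.Adj a w := by
    rcases hK w hw with h | h
    · exact absurd (h x hxA).symm hxw
    · exact fun e => h a haA e.symm
  rcases ha with h | h
  · exact hwA (h w hw)
  · exact h y hy hyA

theorem PHpair_aux (G : SimpleGraph V) (K1 K2 A1 A2 : Set V)
    (hP : IsProperPair G K1 K2)
    (hH : ∀ z, z ∉ K1 → z ∉ K2 → IsCompleteTo G z K2 ∨ IsAnticompleteTo G z K2)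
    (hC4 : IsC4FreePair G A1 A2) (hhom : IsHomogeneousPair G A1 A2) :
    K1 ∩ A1 = ∅ ∨ K1 ∩ A2 = ∅ := by
  by_contra hcon
  rw [not_or, ← ne_eq, ← ne_eq, ← Set.nonempty_iff_ne_empty, ← Set.nonempty_iff_ne_empty] at hcon
  obtain ⟨⟨x1, hx1K, hx1A⟩, ⟨x2, hx2K, hx2A⟩⟩ := hcon
  obtain ⟨-, -, hKd, hK1, hK2, hp, -⟩ := hP
  obtain ⟨-, -, hAd, hA1, hA2, ⟨a, ha, b, hb, hab⟩, hno⟩ := hC4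
  obtain ⟨-, -, -, -, -, hA⟩ := hhom
  have hKd' : ∀ v, v ∈ K1 → v ∉ K2 := fun v h h' => Set.disjoint_left.1 hKd h h'
  have hAd' : ∀ v, v ∈ A1 → v ∉ A2 := fun v h h' => Set.disjoint_left.1 hAd h h'
  have ne_of : ∀ (S : Set V) (u v : V), u ∈ S → v ∉ S → u ≠ v := fun S u v h h' e => h' (e ▸ h)
  obtain ⟨w1, hw1, hxw1⟩ : ∃ w ∈ K2, ¬ G.Adj x1 w := by
    simpa [IsCompleteTo] using (hp x1 hx1K).1
  obtain ⟨w2, hw2, hxw2⟩ : ∃ w ∈ K2, ¬ G.Adj x2 w := by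
    simpa [IsCompleteTo] using (hp x2 hx2K).1
  have hx12 : G.Adj x1 x2 := hK1 hx1K hx2K (ne_of A2 _ _ hx2A (hAd' _ hx1A)).symm
  have n1 : w1 ∉ A1 := fun h => hxw1 (hA1 hx1A h (ne_of K1 _ _ hx1K fun h' => hKd' _ h' hw1))
  have n2 : w2 ∉ A2 := fun h => hxw2 (hA2 hx2A h (ne_of K1 _ _ hx2K fun h' => hKd' _ h' hw2))
  have an1 : w1 ∉ A2 → IsAnticompleteTo G w1 A1 := fun h =>
    (hA w1 (by simp [n1, h])).1.resolve_left fun h' => hxw1 (h' x1 hx1A).symm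
  have an2 : w2 ∉ A1 → IsAnticompleteTo G w2 A2 := fun h =>
    (hA w2 (by simp [n2, h])).2.resolve_left fun h' => hxw2 (h' x2 hx2A).symm
  by_cases m1 : w1 ∈ A2
  · by_cases m2 : w2 ∈ A1
    · have e1 : x1 ≠ w2 := ne_of K1 _ _ hx1K fun h' => hKd' _ h' hw2
      have e2 : x2 ≠ w1 := ne_of K1 _ _ hx2K fun h' => hKd' _ h' hw1
      have e3 : w1 ≠ w2 := ne_of A2 _ _ m1 n2
      exact hno ⟨x1, x2, w1, w2, Or.inl hx1A, Or.inr hx2A, Or.inr m1, Or.inl m2,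
        hx12.ne, ne_of A1 _ _ hx1A n1, e1, e2, ne_of A2 _ _ hx2A n2, e3,
        hx12, hA2 hx2A m1 e2, hK2 hw1 hw2 e3, hA1 m2 hx1A e1.symm, hxw1, hxw2⟩
    · exact an2 m2 w1 m1 (hK2 hw2 hw1 (ne_of A2 _ _ m1 n2).symm)
  · by_cases m2 : w2 ∈ A1
    · exact an1 m1 w2 m2 (hK2 hw1 hw2 (ne_of A1 _ _ m2 n1).symm)
    · have out : ∀ y ∈ K2, y ∉ A1 ∪ A2 := by
        rintro y hy (h | h)
        · exact an1 m1 y h (hK2 hw1 hy (ne_of A1 _ _ h n1).symm)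
        · exact an2 m2 y h (hK2 hw2 hy (ne_of A2 _ _ h n2).symm)
      by_cases haK : a ∈ K1
      · have hbK : b ∉ K1 := fun h => hab (hK1 haK h (ne_of A2 _ _ hb (hAd' _ ha)).symm)
        exact PHpair_aux_side G K2 A2 x2 b hx2A hb (hp x2 hx2K)
          (hH b hbK fun h => out b h (Or.inr hb)) fun y hy => (hA y (out y hy)).2
      · exact PHpair_aux_side G K2 A1 x1 a hx1A ha (hp x1 hx1K)
          (hH a haK fun h => out a h (Or.inl ha)) fun y hy => (hA y (out y hy)).1

/-- Claim 1 of Lemma 9: each clique of a PH pair misses A1 or misses A2, for any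
C4-free homogeneous pair {A1, A2}. -/
theorem PHpair_c4freepair_claim [Fintype V] (G : SimpleGraph V) (K1 K2 A1 A2 : Set V)
    (hPH : IsPHPair G K1 K2)
    (hC4 : IsC4FreePair G A1 A2) (hhom : IsHomogeneousPair G A1 A2) :
    (K1 ∩ A1 = ∅ ∨ K1 ∩ A2 = ∅) ∧ (K2 ∩ A1 = ∅ ∨ K2 ∩ A2 = ∅) := by
  obtain ⟨hP, -, -, -, -, -, hH⟩ := hPH
  refine ⟨PHpair_aux G K1 K2 A1 A2 hP (fun z h h' => (hH z (by simp [h, h'])).2) hC4 hhom,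
    PHpair_aux G K2 K1 A1 A2 ?_ (fun z h h' => (hH z (by simp [h, h'])).1) hC4 hhom⟩
  obtain ⟨h1, h2, h3, h4, h5, h6, h7⟩ := hP
  exact ⟨h2, h1, h3.symm, h5, h4, h7, h6⟩
end

section
/- Let G be a finite simple graph with a proper and homogeneous (PH) pair of cliques {K1, K2} and a C4-free homogeneous pair of cliques {A1, A2}. Then K1 ∩ A2 = K2 ∩ A1 = ∅ or K1 ∩ A1 = K2 ∩ A2 = ∅. -/
open SimpleGraph

variable {V : Type*}

/-- If both `K1` and `K2` meet `A1` then `K2` meets `A2`. -/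
lemma aux_same_side (G : SimpleGraph V) (K1 K2 A1 A2 : Set V)
    (hPH : IsPHPair G K1 K2) (hhom : IsHomogeneousPair G A1 A2)
    (x y : V) (hx : x ∈ K1) (hx' : x ∈ A1) (hy : y ∈ K2) (hy' : y ∈ A1) :
    ∃ z ∈ K2, z ∈ A2 ∧ ¬ G.Adj x z := by
  obtain ⟨⟨-, -, hd, -, hc2, hp1, -⟩, -⟩ := hPH
  obtain ⟨-, -, -, hA1, -, hh⟩ := hhom
  have h := (hp1 x hx).1
  simp only [IsCompleteTo, not_forall] at h
  obtain ⟨z, hz, hxz⟩ := h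
  refine ⟨z, hz, ?_, hxz⟩
  by_contra hz2
  have hne : x ≠ z := fun e => Set.disjoint_left.1 hd hx (e ▸ hz)
  have hz1 : z ∉ A1 := fun h => hxz (hA1 hx' h hne)
  have hzy : G.Adj z y := hc2 hz hy (fun e => hz1 (e ▸ hy'))
  rcases (hh z (by simp [hz1, hz2])).1 with h | h
  · exact hxz (h x hx').symm
  · exact h y hy' hzy

lemma hom_swap {G : SimpleGraph V} {A1 A2 : Set V} (h : IsHomogeneousPair G A1 A2) :
    IsHomogeneousPair G A2 A1 := by
  obtain ⟨a, b, c, d, e, f⟩ := h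
  exact ⟨b, a, c.symm, e, d, fun z hz => (f z (by rwa [Set.union_comm])).symm⟩

lemma ph_swap {G : SimpleGraph V} {A1 A2 : Set V} (h : IsPHPair G A1 A2) :
    IsPHPair G A2 A1 := by
  obtain ⟨⟨a, b, c, d, e, f, g⟩, h⟩ := h
  exact ⟨⟨b, a, c.symm, e, d, g, f⟩, hom_swap h⟩

/-- `K1` cannot meet both `A1` and `A2`. -/
lemma aux_both (G : SimpleGraph V) (K1 K2 A1 A2 : Set V)
    (hPH : IsPHPair G K1 K2)
    (hC4 : IsC4FreePair G A1 A2) (hhom : IsHomogeneousPair G A1 A2)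
    (x y : V) (hx : x ∈ K1) (hx' : x ∈ A1) (hy : y ∈ K1) (hy' : y ∈ A2) : False := by
  have hdA := hhom.2.2.1
  have hdK := hPH.2.2.2.1
  have hK1 := hPH.2.2.2.2.1
  have hK2 := hPH.2.2.2.2.2.1
  have hA1 := hhom.2.2.2.1
  have hA2 := hhom.2.2.2.2.1
  have nK : ∀ {u v}, u ∈ K1 → v ∈ K2 → u ≠ v :=
    fun hu hv e => Set.disjoint_left.1 hdK hu (e ▸ hv)
  have nA : ∀ {u v}, u ∈ A1 → v ∈ A2 → u ≠ v :=
    fun hu hv e => Set.disjoint_left.1 hdA hu (e ▸ hv)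
  by_cases h1 : ∃ q ∈ K2, q ∈ A1
  · obtain ⟨q, hq, hq'⟩ := h1
    obtain ⟨r, hr, hr', -⟩ := aux_same_side G K1 K2 A1 A2 hPH hhom x q hx hx' hq hq'
    obtain ⟨p, hp, hp', hqp⟩ :=
      aux_same_side G K2 K1 A1 A2 (ph_swap hPH) hhom q x hq hq' hx hx'
    obtain ⟨s, hs, hs', hrs⟩ :=
      aux_same_side G K2 K1 A2 A1 (ph_swap hPH) (hom_swap hhom) r y hr hr' hy hy'
    exact hC4.2.2.2.2.2.2 ⟨q, s, p, r, Or.inl hq', Or.inl hs', Or.inr hp', Or.inr hr',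
      (nK hs hq).symm, nA hq' hp', nA hq' hr', nA hs' hp', nA hs' hr', nK hp hr,
      hA1 hq' hs' (nK hs hq).symm, hK1 hs hp (nA hs' hp'), hA2 hp' hr' (nK hp hr),
      hK2 hr hq (nA hq' hr').symm, hqp, fun h => hrs h.symm⟩
  by_cases h2 : ∃ q ∈ K2, q ∈ A2
  · obtain ⟨q, hq, hq'⟩ := h2
    obtain ⟨r, hr, hr', -⟩ :=
      aux_same_side G K1 K2 A2 A1 hPH (hom_swap hhom) y q hy hy' hq hq'
    exact h1 ⟨r, hr, hr'⟩
  push Not at h1 h2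
  obtain ⟨a, ha, b, hb, hab⟩ := hC4.2.2.2.2.2.1
  have haK2 : a ∉ K2 := fun h => h1 a h ha
  have hbK2 : b ∉ K2 := fun h => h2 b h hb
  have hprop := hPH.1.2.2.2.2.2.1
  -- a vertex of A outside K1 is complete to K1
  have haK1 : a ∉ K1 := by
    intro h
    by_cases hbK : b ∈ K1
    · exact hab (hK1 h hbK (nA ha hb))
    · rcases (hPH.2.2.2.2.2.2 b (by simp [hbK, hbK2])).1 with h' | h'
      · exact hab (h' a h).symm
      · exact h' y hy (hA2 hb hy' (fun e => hbK (e ▸ hy)))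
  have hax : G.Adj a x := hA1 ha hx' (fun e => haK1 (e ▸ hx))
  have hP := hprop x hx
  simp only [IsProperTo, IsCompleteTo, IsAnticompleteTo, not_forall, not_not] at hP
  obtain ⟨⟨u, hu, hxu⟩, ⟨v, hv, hxv⟩⟩ := hP
  have hav : G.Adj v a := by
    rcases (hhom.2.2.2.2.2 v (by simp [h1 v hv, h2 v hv])).1 with h | h
    · exact h a ha
    · exact absurd hxv.symm (h x hx')
  have hau : G.Adj a u := by
    rcases (hPH.2.2.2.2.2.2 a (by simp [haK1, haK2])).2 with h | h
    · exact h u hu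
    · exact absurd hav.symm (h v hv)
  rcases (hhom.2.2.2.2.2 u (by simp [h1 u hu, h2 u hu])).1 with h | h
  · exact hxu (h x hx').symm
  · exact h a ha hau.symm

/-- Lemma 9: for a PH pair {K1, K2} and a C4-free homogeneous pair {A1, A2},
either K1 ∩ A2 = K2 ∩ A1 = ∅ or K1 ∩ A1 = K2 ∩ A2 = ∅. -/
theorem PHpair_c4freepair_intersections [Fintype V] (G : SimpleGraph V)
    (K1 K2 A1 A2 : Set V)
    (hPH : IsPHPair G K1 K2)
    (hC4 : IsC4FreePair G A1 A2) (hhom : IsHomogeneousPair G A1 A2) :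
    (K1 ∩ A2 = ∅ ∧ K2 ∩ A1 = ∅) ∨ (K1 ∩ A1 = ∅ ∧ K2 ∩ A2 = ∅) := by
  have hb1 := aux_both G K1 K2 A1 A2 hPH hC4 hhom
  have hb2 := aux_both G K2 K1 A1 A2 (ph_swap hPH) hC4 hhom
  have hs1 := aux_same_side G K1 K2 A1 A2 hPH hhom
  have hs2 := aux_same_side G K1 K2 A2 A1 hPH (hom_swap hhom)
  simp only [Set.eq_empty_iff_forall_notMem, Set.mem_inter_iff, not_and]
  by_contra hcon
  rw [not_or, not_and_or, not_and_or] at hcon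
  push Not at hcon
  obtain ⟨⟨p, hp, hp'⟩ | ⟨p, hp, hp'⟩, ⟨q, hq, hq'⟩ | ⟨q, hq, hq'⟩⟩ := hcon
  · exact hb1 q p hq hq' hp hp'
  · obtain ⟨z, hz, hz', -⟩ := hs2 p q hp hp' hq hq'
    exact hb2 z q hz hz' hq hq'
  · obtain ⟨z, hz, hz', -⟩ := hs1 q p hq hq' hp hp'
    exact hb2 p z hp hp' hz hz'
  · exact hb2 p q hp hp' hq hq'
end

section
/- Let G be a finite simple graph and let {Q1, Q2} be a homogeneous pair of cliques in G. Then every induced cycle of length at least 5 and odd in G, and every induced cycle of length at least 5 and odd in the complement of G, contains at most one vertex of Q1 and at most one vertex of Q2. -/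
open SimpleGraph

variable {V : Type*}

/-- `f : ZMod n → V` is an induced (chordless) cycle of length `n` in `G`:
it is injective and adjacency holds exactly between consecutive vertices. -/
def IsInducedCycle (G : SimpleGraph V) (n : ℕ) (f : ZMod n → V) : Prop :=
  3 ≤ n ∧ Function.Injective f ∧
    ∀ i j : ZMod n, G.Adj (f i) (f j) ↔ (j = i + 1 ∨ i = j + 1)

/-- Adjacency in the cycle on `ZMod n`. -/
def CycAdj {n : ℕ} (i j : ZMod n) : Prop := j = i + 1 ∨ i = j + 1

theorem zmod_small_ne {n : ℕ} (k : ℕ) (h : ¬ n ∣ k) : (k : ZMod n) ≠ 0 := by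
  intro h0
  exact h ((ZMod.natCast_eq_zero_iff k n).1 h0)

theorem zmod_facts {n : ℕ} (h5 : 5 ≤ n) (ho : Odd n) :
    (1 : ZMod n) ≠ 0 ∧ (2 : ZMod n) ≠ 0 ∧ (3 : ZMod n) ≠ 0 ∧ (4 : ZMod n) ≠ 0 ∧
      (6 : ZMod n) ≠ 0 := by
  have small : ∀ k : ℕ, 0 < k → k < 5 → (k : ZMod n) ≠ 0 := fun k hk hk5 =>
    zmod_small_ne k (fun hd => by have := Nat.le_of_dvd hk hd; omega)
  refine ⟨by exact_mod_cast small 1 (by norm_num) (by norm_num),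
    by exact_mod_cast small 2 (by norm_num) (by norm_num),
    by exact_mod_cast small 3 (by norm_num) (by norm_num),
    by exact_mod_cast small 4 (by norm_num) (by norm_num), ?_⟩
  have : ((6 : ℕ) : ZMod n) ≠ 0 := by
    refine zmod_small_ne 6 (fun hd => ?_)
    have := Nat.le_of_dvd (by norm_num) hd
    obtain ⟨m, hm⟩ := ho
    have : n = 5 := by omega
    subst this
    omega
  exact_mod_cast this

/-- A vertex outside `A ∪ B` with both cycle neighbours in `A` is impossible. -/
theorem no_middle {n : ℕ} (h5 : 5 ≤ n) (ho : Odd n) (A B : ZMod n → Prop)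
    (iA : ∀ i j, A i → A j → ¬ CycAdj i j) (iB : ∀ i j, B i → B j → ¬ CycAdj i j)
    (hA : ∀ z, ¬ A z → ¬ B z → ∀ i j, A i → A j → CycAdj z i → CycAdj z j)
    (hB : ∀ z, ¬ A z → ¬ B z → ∀ i j, B i → B j → CycAdj z i → CycAdj z j)
    (z : ZMod n) (hzB : ¬ B z) (a1 : A (z + 1)) (a2 : A (z - 1)) : False := by
  obtain ⟨h1, h2, h3, h4, h6⟩ := zmod_facts h5 ho
  have nb2 : B (z + 2) := by
    by_contra hb
    have ha : ¬ A (z + 2) := fun ha => iA _ _ a1 ha (Or.inl (by ring))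
    rcases hA _ ha hb _ _ a1 a2 (Or.inr (by ring)) with h | h
    · exact h4 (by linear_combination -h)
    · exact h2 (by linear_combination h)
  have nb2' : B (z - 2) := by
    by_contra hb
    have ha : ¬ A (z - 2) := fun ha => iA _ _ a2 ha (Or.inr (by ring))
    rcases hA _ ha hb _ _ a2 a1 (Or.inl (by ring)) with h | h
    · exact h2 (by linear_combination h)
    · exact h4 (by linear_combination -h)
  have nb3 : ¬ B (z + 3) := fun hb => iB _ _ nb2 hb (Or.inl (by ring))
  have na3 : ¬ A (z + 3) := by
    intro ha
    rcases hA z (fun h => iA _ _ h a1 (Or.inl rfl)) hzB _ _ a1 ha (Or.inl rfl) with h | h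
    · exact h2 (by linear_combination h)
    · exact h4 (by linear_combination -h)
  rcases hB _ na3 nb3 _ _ nb2 nb2' (Or.inr (by ring)) with h | h
  · exact h6 (by linear_combination -h)
  · exact h4 (by linear_combination h)

/-- If `A` has two vertices, then every cycle neighbour of a vertex in `A` is in `B`. -/
theorem nbr_mem {n : ℕ} (h5 : 5 ≤ n) (ho : Odd n) (A B : ZMod n → Prop)
    (iA : ∀ i j, A i → A j → ¬ CycAdj i j) (iB : ∀ i j, B i → B j → ¬ CycAdj i j)
    (hA : ∀ z, ¬ A z → ¬ B z → ∀ i j, A i → A j → CycAdj z i → CycAdj z j)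
    (hB : ∀ z, ¬ A z → ¬ B z → ∀ i j, B i → B j → CycAdj z i → CycAdj z j)
    (i j : ZMod n) (hi : A i) (hj : A j) (hij : i ≠ j) (k z : ZMod n) (hk : A k)
    (hz : CycAdj z k) : B z := by
  by_contra hb
  have ha : ¬ A z := fun ha => iA _ _ ha hk hz
  have key : A (z + 1) ∧ A (z - 1) := by
    rcases hA z ha hb k i hk hi hz with h | h <;> rcases hA z ha hb k j hk hj hz with h' | h'
    · exact absurd (h.trans h'.symm) hij
    · exact ⟨h ▸ hi, by rw [h', add_sub_cancel_right]; exact hj⟩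
    · exact ⟨h' ▸ hj, by rw [h, add_sub_cancel_right]; exact hi⟩
    · exact absurd (add_right_cancel (h.symm.trans h')) hij
  exact no_middle h5 ho A B iA iB hA hB z hb key.1 key.2

theorem antihole_aux {n : ℕ} (h5 : 5 ≤ n) (ho : Odd n) (A B : ZMod n → Prop)
    (iA : ∀ i j, A i → A j → ¬ CycAdj i j) (iB : ∀ i j, B i → B j → ¬ CycAdj i j)
    (hA : ∀ z, ¬ A z → ¬ B z → ∀ i j, A i → A j → CycAdj z i → CycAdj z j)
    (hB : ∀ z, ¬ A z → ¬ B z → ∀ i j, B i → B j → CycAdj z i → CycAdj z j)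
    (i j : ZMod n) (hi : A i) (hj : A j) : i = j := by
  by_contra hij
  obtain ⟨h1, h2, h3, h4, h6⟩ := zmod_facts h5 ho
  have toB := nbr_mem h5 ho A B iA iB hA hB i j hi hj hij
  have b1 : B (i + 1) := toB i _ hi (Or.inr rfl)
  have b2 : B (i - 1) := toB i _ hi (Or.inl (by ring))
  have toA := nbr_mem h5 ho B A iB iA (fun z a b => hB z b a) (fun z a b => hA z b a)
    (i + 1) (i - 1) b1 b2 (fun h => h2 (by linear_combination h))
  have all : ∀ m : ℕ, A (i + 2 * m) := by
    intro m
    induction m with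
    | zero => simpa using hi
    | succ m ih =>
      have hb := toB _ (i + 2 * m + 1) ih (Or.inr rfl)
      have ha := toA _ (i + 2 * m + 1 + 1) hb (Or.inr rfl)
      have e : i + 2 * ((m + 1 : ℕ) : ZMod n) = i + 2 * m + 1 + 1 := by push_cast; ring
      rw [e]; exact ha
  obtain ⟨m, hm⟩ := ho
  have h0 : (2 * (m : ZMod n) + 1) = 0 := by
    have := ZMod.natCast_self n
    rw [hm] at this
    rw [hm]
    exact_mod_cast this
  exact iA _ _ (all m) hi (Or.inl (by linear_combination -h0))

theorem antihole_half (G : SimpleGraph V) (Q1 Q2 : Set V) (hhom : IsHomogeneousPair G Q1 Q2)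
    (n : ℕ) (f : ZMod n → V) (h5 : 5 ≤ n) (ho : Odd n) (hc : IsInducedCycle Gᶜ n f) :
    ∀ i j : ZMod n, f i ∈ Q1 → f j ∈ Q1 → i = j := by
  obtain ⟨-, -, -, c1, c2, hz⟩ := hhom
  obtain ⟨-, -, hadj⟩ := hc
  have indep : ∀ Q : Set V, G.IsClique Q → ∀ i j, f i ∈ Q → f j ∈ Q → ¬ CycAdj i j := by
    intro Q hQ i j hi hj hij
    have h := (hadj i j).2 hij
    rw [SimpleGraph.compl_adj] at h
    exact h.2 (hQ hi hj h.1)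
  have hom : ∀ Q : Set V, ∀ z, f z ∉ Q →
      (IsCompleteTo G (f z) Q ∨ IsAnticompleteTo G (f z) Q) →
      ∀ i j, f i ∈ Q → f j ∈ Q → CycAdj z i → CycAdj z j := by
    intro Q z hzQ hQ i j hi hj hzi
    have h := (hadj z i).2 hzi
    rw [SimpleGraph.compl_adj] at h
    refine (hadj z j).1 ?_
    rw [SimpleGraph.compl_adj]
    refine ⟨fun e => hzQ (e ▸ hj), ?_⟩
    rcases hQ with hQ | hQ
    · exact absurd (hQ _ hi) h.2
    · exact hQ _ hj
  exact antihole_aux h5 ho (fun i => f i ∈ Q1) (fun i => f i ∈ Q2) (indep Q1 c1) (indep Q2 c2)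
    (fun z a b => hom Q1 z a (hz (f z) (by simp [a, b])).1)
    (fun z a b => hom Q2 z b (hz (f z) (by simp [a, b])).2)

theorem hole_half (G : SimpleGraph V) (Q1 Q2 : Set V) (hhom : IsHomogeneousPair G Q1 Q2)
    (n : ℕ) (f : ZMod n → V) (h5 : 5 ≤ n) (ho : Odd n) (hc : IsInducedCycle G n f) :
    ∀ i j : ZMod n, f i ∈ Q1 → f j ∈ Q1 → i = j := by
  obtain ⟨-, -, -, c1, c2, hz⟩ := hhom
  obtain ⟨-, inj, hadj⟩ := hc
  obtain ⟨h1, h2, h3, h4, h6⟩ := zmod_facts h5 ho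
  -- a vertex distinguishing two vertices of `Q1` and outside `Q1` is in `Q2`
  have dist : ∀ z i j, f i ∈ Q1 → f j ∈ Q1 → f z ∉ Q1 → G.Adj (f z) (f i) →
      ¬ G.Adj (f z) (f j) → f z ∈ Q2 := by
    intro z i j hi hj hzQ hzi hzj
    by_contra hb
    rcases (hz (f z) (by simp [hzQ, hb])).1 with h | h
    · exact hzj (h _ hj)
    · exact h _ hi hzi
  have main : ∀ i, f i ∈ Q1 → f (i + 1) ∈ Q1 → False := by
    intro i hi hj
    have n1 : ¬ G.Adj (f (i - 1)) (f (i + 1)) := by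
      rw [hadj]
      rintro (h | h)
      · exact h1 (by linear_combination h)
      · exact h3 (by linear_combination -h)
    have n2 : ¬ G.Adj (f (i + 2)) (f i) := by
      rw [hadj]
      rintro (h | h)
      · exact h3 (by linear_combination -h)
      · exact h1 (by linear_combination h)
    have m1 : f (i - 1) ∈ Q2 := by
      refine dist _ i (i + 1) hi hj (fun hq => n1 (c1 hq hj ?_)) ((hadj _ _).2 (Or.inl (by ring))) n1
      exact fun e => h2 (by linear_combination -(inj e))
    have m2 : f (i + 2) ∈ Q2 := by
      refine dist _ (i + 1) i hj hi (fun hq => n2 (c1 hq hi ?_)) ((hadj _ _).2 (Or.inr (by ring))) n2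
      exact fun e => h2 (by linear_combination (inj e))
    have := c2 m1 m2 (fun e => h3 (by linear_combination -(inj e)))
    rcases (hadj _ _).1 this with h | h
    · exact h2 (by linear_combination h)
    · exact h4 (by linear_combination -h)
  intro i j hi hj
  by_contra hij
  rcases (hadj i j).1 (c1 hi hj (fun e => hij (inj e))) with h | h
  · exact main i hi (h ▸ hj)
  · exact main j hj (h ▸ hi)

theorem IsHomogeneousPair.swap {G : SimpleGraph V} {Q1 Q2 : Set V}
    (h : IsHomogeneousPair G Q1 Q2) : IsHomogeneousPair G Q2 Q1 := by
  obtain ⟨a, b, c, d, e, hz⟩ := h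
  exact ⟨b, a, c.symm, e, d, fun z hzn => (hz z (by rwa [Set.union_comm])).symm⟩

/-- For a homogeneous pair of cliques {Q1, Q2}, every long odd hole of G and every long
odd antihole of G contains at most one vertex of Q1 and at most one vertex of Q2. -/
theorem homogeneous_pair_long_odd_holes [Fintype V] (G : SimpleGraph V) (Q1 Q2 : Set V)
    (hhom : IsHomogeneousPair G Q1 Q2) :
    ∀ (n : ℕ) (f : ZMod n → V), 5 ≤ n → Odd n →
      (IsInducedCycle G n f ∨ IsInducedCycle Gᶜ n f) →
      (∀ i j : ZMod n, f i ∈ Q1 → f j ∈ Q1 → i = j) ∧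
      (∀ i j : ZMod n, f i ∈ Q2 → f j ∈ Q2 → i = j) := by
  intro n f h5 ho hc
  rcases hc with hc | hc
  · exact ⟨hole_half G Q1 Q2 hhom n f h5 ho hc, hole_half G Q2 Q1 hhom.swap n f h5 ho hc⟩
  · exact ⟨antihole_half G Q1 Q2 hhom n f h5 ho hc,
      antihole_half G Q2 Q1 hhom.swap n f h5 ho hc⟩
end

section
/- For every finite simple graph G there exists a finite simple graph G' with no proper and homogeneous pair of cliques such that χ(G') = χ(G) and ω(G') = ω(G). -/
open SimpleGraph

variable {V : Type*}

/-- The clique number of a graph. -/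
noncomputable def cliqueNum' {W : Type*} (G : SimpleGraph W) : ℕ :=
  sSup {n | ∃ s : Finset W, G.IsNClique n s}

/-- `G` with a pendant vertex attached to every non-isolated vertex. -/
def pendantGraph {V : Type} (G : SimpleGraph V) : SimpleGraph (V ⊕ V) where
  Adj x y := match x, y with
    | .inl a, .inl b => G.Adj a b
    | .inl a, .inr b => a = b ∧ ∃ w, G.Adj a w
    | .inr a, .inl b => a = b ∧ ∃ w, G.Adj a w
    | .inr _, .inr _ => False
  symm := ⟨by
    rintro (a | a) (b | b) h
    · exact SimpleGraph.Adj.symm h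
    · obtain ⟨rfl, h⟩ := h; exact ⟨rfl, h⟩
    · obtain ⟨rfl, h⟩ := h; exact ⟨rfl, h⟩
    · exact h⟩
  loopless := ⟨by
    rintro (a | a) h
    · exact G.loopless.irrefl a h
    · exact h⟩

lemma pendant_hom_to {V : Type} (G : SimpleGraph V) : Nonempty (pendantGraph G →g G) := by
  classical
  refine ⟨⟨fun x => match x with
    | .inl a => a
    | .inr a => if h : ∃ w, G.Adj a w then h.choose else a, ?_⟩⟩
  rintro (a | a) (b | b) h
  · exact h
  · obtain ⟨rfl, h⟩ := h
    simpa [h] using h.choose_spec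
  · obtain ⟨rfl, h⟩ := h
    simpa [h] using h.choose_spec.symm
  · exact h.elim

lemma hom_clique {V W : Type} {G : SimpleGraph V} {H : SimpleGraph W} (f : G →g H) {n : ℕ}
    (h : ∃ s : Finset V, G.IsNClique n s) : ∃ s : Finset W, H.IsNClique n s := by
  classical
  obtain ⟨s, hs⟩ := h
  refine ⟨s.image f, ?_, ?_⟩
  · intro x hx y hy hne
    simp only [Finset.coe_image, Set.mem_image] at hx hy
    obtain ⟨a, ha, rfl⟩ := hx
    obtain ⟨b, hb, rfl⟩ := hy
    exact f.map_adj (hs.1 ha hb (fun e => hne (by rw [e])))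
  · rw [Finset.card_image_of_injOn, hs.2]
    intro a ha b hb e
    by_contra hne
    exact (f.map_adj (hs.1 ha hb hne)).ne e

/-- A vertex proper to `K` yields, for each `u`, an element of `K` other than `u`. -/
lemma exists_other {W : Type} {G : SimpleGraph W} {x : W} {K : Set W} (h : IsProperTo G x K)
    (u : W) : ∃ v ∈ K, v ≠ u := by
  obtain ⟨h1, h2⟩ := h
  simp only [IsCompleteTo, IsAnticompleteTo, not_forall, not_not] at h1 h2
  obtain ⟨a, ha, hna⟩ := h1
  obtain ⟨b, hb, hab⟩ := h2
  by_cases e : a = u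
  · exact ⟨b, hb, fun e' => hna (by rw [e, ← e']; exact hab)⟩
  · exact ⟨a, ha, e⟩

lemma pendant_PHfree {V : Type} (G : SimpleGraph V) (K1 K2 : Set (V ⊕ V)) :
    ¬ IsPHPair (pendantGraph G) K1 K2 := by
  rintro ⟨⟨⟨u, hu⟩, ⟨y, hy⟩, hd, c1, c2, p1, p2⟩, -, -, -, -, -, hom⟩
  have key : ∀ (A B : Set (V ⊕ V)), Disjoint A B → (pendantGraph G).IsClique A →
      (∀ u ∈ A, IsProperTo (pendantGraph G) u B) → (∃ y, IsProperTo (pendantGraph G) y A) →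
      ∀ v, Sum.inr v ∉ A := by
    rintro A B hd c p ⟨y, hy⟩ v hv
    obtain ⟨x, hx, hne⟩ := exists_other hy (Sum.inr v)
    have hadj := c hv hx hne.symm
    have h2 := (p _ hv).2
    simp only [IsAnticompleteTo, not_forall, not_not] at h2
    obtain ⟨b, hb, hvb⟩ := h2
    rcases x with x | x
    · rcases b with b | b
      · have e1 : v = x := hadj.1
        have e2 : v = b := hvb.1
        subst e1; subst e2
        exact Set.disjoint_left.mp hd hx hb
      · exact hvb
    · exact hadj
  have k1 := key K1 K2 hd c1 p1 ⟨y, p2 y hy⟩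
  have k2 := key K2 K1 hd.symm c2 p2 ⟨u, p1 u hu⟩
  obtain ⟨x, hx, hne⟩ := exists_other (p2 y hy) u
  rcases u with u | u
  swap
  · exact k1 u hu
  rcases x with x | x
  swap
  · exact k1 x hx
  have hadj : G.Adj u x := c1 hu hx hne.symm
  rcases (hom (Sum.inr u) (by rintro (h | h); exacts [k1 u h, k2 u h])).1 with h | h
  · have e : u = x := (h _ hx).1
    exact hne (by rw [e])
  · exact h _ hu ⟨rfl, x, hadj⟩

/-- Corollary 16: every finite graph G admits a finite graph G' without proper and
homogeneous pairs of cliques having the same chromatic number and clique number. -/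
theorem exists_PHfree_same_chromatic_clique {V : Type} [Fintype V] (G : SimpleGraph V) :
    ∃ (W : Type) (_ : Fintype W) (G' : SimpleGraph W),
      (∀ K1 K2 : Set W, ¬ IsPHPair G' K1 K2) ∧
      G'.chromaticNumber = G.chromaticNumber ∧
      cliqueNum' G' = cliqueNum' G := by
  obtain ⟨f⟩ := pendant_hom_to G
  let g : G →g pendantGraph G := ⟨Sum.inl, fun h => h⟩
  refine ⟨V ⊕ V, inferInstance, pendantGraph G, pendant_PHfree G, ?_, ?_⟩
  · exact le_antisymm (chromaticNumber_mono_of_hom f) (chromaticNumber_mono_of_hom g)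
  · unfold cliqueNum'
    congr 1
    ext n
    exact ⟨hom_clique f, hom_clique g⟩
end
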